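/- arXiv:1704.06882 — 5 statements merged into one kernel-verified Lean document; each statement's English description precedes it below -/
import Mathlib

section
/- (Explicit error propagation formula) For all k ≥ 0 and n ≥ 1, the errors of linear θ-parareal satisfy e_n^{(k+1)} = Σ_{j=0}^{n−1} G^j (F − G) e_{n−1−j}^{(k)}. -/
/-- Discrete variation of constants: the solution of `x (n + 1) = G (x n) + f n` with `x 0 = 0`. -/
theorem eq_sum_pow_apply_of_affine_recurrence
    {R M : Type*} [Semiring R] [AddCommMonoid M] [TopologicalSpace M] [Module R M]
    (G : M →L[R] M) (x f : ℕ → M) (hzero : x 0 = 0)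
    (hsucc : ∀ n, x (n + 1) = G (x n) + f n) (n : ℕ) :
    x n = ∑ j ∈ Finset.range n, (G ^ j) (f (n - 1 - j)) := by
  induction n with
  | zero => simpa using hzero
  | succ n ih =>
    rw [hsucc, ih, Finset.sum_range_succ', map_sum]
    congr 1
    refine Finset.sum_congr rfl fun j _ => ?_
    rw [pow_succ', mul_apply_eq_comp]
    congr 3
    omega

/-- **Explicit error propagation formula.**
For all `k ≥ 0` and `n ≥ 1`, the errors `e n k = u n k - F^n u₀` of linear
θ-parareal satisfy `e n (k+1) = ∑_{j=0}^{n-1} G^j (F - G) (e (n-1-j) k)`. -/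
theorem linear_theta_parareal_error_propagation
    {E : Type*} [NormedAddCommGroup E] [NormedSpace ℝ E] [FiniteDimensional ℝ E]
    (u₀ : E) (F G : E →L[ℝ] E)
    (u : ℕ → ℕ → E)
    (h0 : ∀ k, u 0 k = u₀)
    (hinit : ∀ n, u (n + 1) 0 = G (u n 0))
    (hrec : ∀ n k, u (n + 1) (k + 1) = G (u n (k + 1)) + F (u n k) - G (u n k)) :
    ∀ k n, 1 ≤ n → u n (k + 1) - (F ^ n) u₀ =
      ∑ j ∈ Finset.range n,
        (G ^ j) ((F - G) (u (n - 1 - j) k - (F ^ (n - 1 - j)) u₀)) := by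
  intro k n _
  refine eq_sum_pow_apply_of_affine_recurrence G (fun n => u n (k + 1) - (F ^ n) u₀)
    (fun n => (F - G) (u n k - (F ^ n) u₀)) (by simp [h0]) (fun n => ?_) n
  simp only [hrec, pow_succ', mul_apply_eq_comp, sub_apply,
    map_sub]
  abel
end

section
/- (Theorem 2.2, error bound for linear θ-parareal) For all k ≥ 0 and all n with k+2 ≤ n, the error satisfies ‖e_n^{(k+1)}‖ ≤ ‖F − G‖ · (Σ_{j=0}^{n−k−2} ‖G‖^j) · max_{0 ≤ m ≤ n−1} ‖e_m^{(k)}‖, where ‖F − G‖ and ‖G‖ are operator norms. -/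
section Parareal

variable {E : Type*} [NormedAddCommGroup E] [NormedSpace ℝ E] {u₀ : E} {F G : E →L[ℝ] E}
  {u : ℕ → ℕ → E}

theorem parareal_error_succ
    (hrec : ∀ n k, u (n + 1) (k + 1) = G (u n (k + 1)) + F (u n k) - G (u n k)) (n k : ℕ) :
    u (n + 1) (k + 1) - (F ^ (n + 1)) u₀ =
      G (u n (k + 1) - (F ^ n) u₀) + (F - G) (u n k - (F ^ n) u₀) := by
  rw [hrec, pow_succ', mul_apply_eq_comp]
  simp only [map_sub, sub_apply]
  abel

/-- After `k` iterations, parareal is exact at the first `k + 1` time points. -/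
theorem parareal_error_eq_zero (h0 : ∀ k, u 0 k = u₀)
    (hrec : ∀ n k, u (n + 1) (k + 1) = G (u n (k + 1)) + F (u n k) - G (u n k)) {n k : ℕ}
    (hnk : n ≤ k) : u n k - (F ^ n) u₀ = 0 := by
  induction n generalizing k with
  | zero => simp [h0]
  | succ n ih =>
    obtain ⟨k, rfl⟩ := Nat.exists_eq_add_of_lt hnk
    rw [parareal_error_succ hrec, ih (by omega), ih (by omega), map_zero, map_zero, add_zero]

theorem norm_parareal_error_le (h0 : ∀ k, u 0 k = u₀)
    (hrec : ∀ n k, u (n + 1) (k + 1) = G (u n (k + 1)) + F (u n k) - G (u n k)) {k d : ℕ} {M : ℝ}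
    (hM : ∀ m < k + 1 + d, ‖u m k - (F ^ m) u₀‖ ≤ M) :
    ‖u (k + 1 + d) (k + 1) - (F ^ (k + 1 + d)) u₀‖ ≤
      ‖F - G‖ * (∑ j ∈ Finset.range d, ‖G‖ ^ j) * M := by
  induction d with
  | zero => rw [add_zero, parareal_error_eq_zero h0 hrec le_rfl]; simp
  | succ d ih =>
    rw [← add_assoc, parareal_error_succ hrec, geom_sum_succ]
    calc _ ≤ ‖G‖ * ‖u (k + 1 + d) (k + 1) - (F ^ (k + 1 + d)) u₀‖ +
          ‖F - G‖ * ‖u (k + 1 + d) k - (F ^ (k + 1 + d)) u₀‖ :=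
        norm_add_le_of_le (G.le_opNorm _) ((F - G).le_opNorm _)
      _ ≤ ‖G‖ * (‖F - G‖ * (∑ j ∈ Finset.range d, ‖G‖ ^ j) * M) + ‖F - G‖ * M := by
        gcongr
        · exact ih fun m hm => hM m (by omega)
        · exact hM _ (by omega)
      _ = _ := by ring

end Parareal

/-- **Theorem 2.2: error bound for linear θ-parareal.**
For all `k ≥ 0` and all `n ≥ k+2`, the error `e n k = u n k - F^n u₀` satisfies
`‖e n (k+1)‖ ≤ ‖F - G‖ ⬝ (∑_{j=0}^{n-k-2} ‖G‖^j) ⬝ max_{0 ≤ m ≤ n-1} ‖e m k‖`. -/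
theorem linear_theta_parareal_error_bound
    {E : Type*} [NormedAddCommGroup E] [NormedSpace ℝ E] [FiniteDimensional ℝ E]
    (u₀ : E) (F G : E →L[ℝ] E)
    (u : ℕ → ℕ → E)
    (h0 : ∀ k, u 0 k = u₀)
    (hinit : ∀ n, u (n + 1) 0 = G (u n 0))
    (hrec : ∀ n k, u (n + 1) (k + 1) = G (u n (k + 1)) + F (u n k) - G (u n k)) :
    ∀ k n, ∀ hn : k + 2 ≤ n,
      ‖u n (k + 1) - (F ^ n) u₀‖ ≤
        ‖F - G‖ * (∑ j ∈ Finset.range (n - k - 1), ‖G‖ ^ j) *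
          ((Finset.range n).sup' (Finset.nonempty_range_iff.mpr (by omega))
            fun m => ‖u m k - (F ^ m) u₀‖) := by
  intro k n hn
  obtain ⟨d, rfl⟩ := Nat.exists_eq_add_of_le (show k + 1 ≤ n by omega)
  rw [show k + 1 + d - k - 1 = d by omega]
  exact norm_parareal_error_le h0 hrec fun m hm =>
    Finset.le_sup' (fun m => ‖u m k - (F ^ m) u₀‖) (Finset.mem_range.mpr hm)
end

section
/- (Convergence with a strictly stable coarse solver) Suppose ‖G‖ ≤ r₀ for some r₀ < 1, and that the gap between fine and effective coarse solvers satisfies ‖F − G‖ ≤ (1 − r₀)ρ for some ρ < 1 (operator norms). Then for every N ≥ 0 and every k ≥ 0, max_{0 ≤ n ≤ N} ‖e_n^{(k)}‖ ≤ ρ^k · max_{0 ≤ n ≤ N} ‖e_n^{(0)}‖; in particular u_n^{(k)} → F^n u₀ as k → ∞, uniformly in 0 ≤ n ≤ N, even if F and G are not consistent with the same differential equation. -/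
/-- A solution of `e (n+1) (k+1) = G (e n (k+1)) + H (e n k)` with zero initial values contracts in
`k` with factor `ρ` when `‖G‖ ≤ r < 1` and `‖H‖ ≤ (1 - r) ρ`. -/
theorem norm_le_pow_mul_of_parareal_recursion
    {E : Type*} [SeminormedAddCommGroup E] [NormedSpace ℝ E] {G H : E →L[ℝ] E} {e : ℕ → ℕ → E}
    {r ρ M : ℝ} {N : ℕ} (hG : ‖G‖ ≤ r) (hr : r < 1) (hH : ‖H‖ ≤ (1 - r) * ρ)
    (h0 : ∀ k, e 0 k = 0) (hrec : ∀ n k, e (n + 1) (k + 1) = G (e n (k + 1)) + H (e n k))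
    (hM : ∀ n ≤ N, ‖e n 0‖ ≤ M) (k : ℕ) : ∀ n ≤ N, ‖e n k‖ ≤ ρ ^ k * M := by
  have hρ : 0 ≤ ρ := nonneg_of_mul_nonneg_right ((norm_nonneg H).trans hH) (sub_pos.mpr hr)
  have hM0 : 0 ≤ M := (norm_nonneg _).trans (hM 0 (Nat.zero_le N))
  induction k with
  | zero => simpa using hM
  | succ k ihk =>
    intro n
    induction n with
    | zero =>
      intro _
      rw [h0, norm_zero]
      positivity
    | succ n ihn =>
      intro hn
      have hn' : n ≤ N := Nat.le_of_succ_le hn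
      calc ‖e (n + 1) (k + 1)‖ ≤ ‖G (e n (k + 1))‖ + ‖H (e n k)‖ := by
            rw [hrec]
            exact norm_add_le _ _
        _ ≤ r * (ρ ^ (k + 1) * M) + (1 - r) * ρ * (ρ ^ k * M) :=
            add_le_add (G.le_of_opNorm_le_of_le hG (ihn hn'))
              (H.le_of_opNorm_le_of_le hH (ihk n hn'))
        _ = ρ ^ (k + 1) * M := by ring

open Filter in
/-- **Convergence with a strictly stable coarse solver.**
If `‖G‖ ≤ r₀ < 1` and `‖F - G‖ ≤ (1 - r₀) ρ` with `ρ < 1`, then for every `N` and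
every `k`, `max_{0 ≤ n ≤ N} ‖e n k‖ ≤ ρ^k ⬝ max_{0 ≤ n ≤ N} ‖e n 0‖`; in particular
`u n k → F^n u₀` as `k → ∞`, even if `F` and `G` are not consistent with the same
differential equation. -/
theorem linear_theta_parareal_convergence_strictly_stable
    {E : Type*} [NormedAddCommGroup E] [NormedSpace ℝ E] [FiniteDimensional ℝ E]
    (u₀ : E) (F G : E →L[ℝ] E)
    (u : ℕ → ℕ → E)
    (h0 : ∀ k, u 0 k = u₀)
    (hinit : ∀ n, u (n + 1) 0 = G (u n 0))
    (hrec : ∀ n k, u (n + 1) (k + 1) = G (u n (k + 1)) + F (u n k) - G (u n k))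
    (r₀ ρ : ℝ) (hG : ‖G‖ ≤ r₀) (hr₀ : r₀ < 1) (hρ : ρ < 1)
    (hgap : ‖F - G‖ ≤ (1 - r₀) * ρ) :
    (∀ N k, ((Finset.range (N + 1)).sup' (Finset.nonempty_range_iff.mpr (Nat.succ_ne_zero N))
        fun n => ‖u n k - (F ^ n) u₀‖) ≤
      ρ ^ k * ((Finset.range (N + 1)).sup' (Finset.nonempty_range_iff.mpr (Nat.succ_ne_zero N))
        fun n => ‖u n 0 - (F ^ n) u₀‖)) ∧
    (∀ n, Tendsto (fun k => u n k) atTop (nhds ((F ^ n) u₀))) := by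
  have hρ0 : 0 ≤ ρ := nonneg_of_mul_nonneg_right ((norm_nonneg _).trans hgap) (sub_pos.mpr hr₀)
  have hbound : ∀ N k, ((Finset.range (N + 1)).sup'
        (Finset.nonempty_range_iff.mpr (Nat.succ_ne_zero N)) fun n => ‖u n k - (F ^ n) u₀‖) ≤
      ρ ^ k * ((Finset.range (N + 1)).sup' (Finset.nonempty_range_iff.mpr (Nat.succ_ne_zero N))
        fun n => ‖u n 0 - (F ^ n) u₀‖) := by
    intro N k
    refine Finset.sup'_le _ _ fun n hn => ?_
    refine norm_le_pow_mul_of_parareal_recursion (e := fun n k => u n k - (F ^ n) u₀)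
      hG hr₀ hgap (fun k => by simp [h0]) (fun n k => ?_) (fun m hm => ?_) k n
      (Finset.mem_range_succ_iff.mp hn)
    · have hF : (F ^ (n + 1)) u₀ = F ((F ^ n) u₀) := by rw [pow_succ']; rfl
      simp only [hrec, hF, map_sub, sub_apply]
      abel
    · exact Finset.le_sup' (fun n => ‖u n 0 - (F ^ n) u₀‖) (Finset.mem_range_succ_iff.mpr hm)
  refine ⟨hbound, fun n => tendsto_iff_norm_sub_tendsto_zero.mpr ?_⟩
  have hlim := (tendsto_pow_atTop_nhds_zero_of_lt_one hρ0 hρ).mul_const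
    ((Finset.range (n + 1)).sup' (Finset.nonempty_range_iff.mpr (Nat.succ_ne_zero n))
      fun m => ‖u m 0 - (F ^ m) u₀‖)
  rw [zero_mul] at hlim
  exact squeeze_zero (fun _ => norm_nonneg _) (fun k =>
    (Finset.le_sup' (fun m => ‖u m k - (F ^ m) u₀‖) (Finset.self_mem_range_succ n)).trans
      (hbound n k)) hlim
end

section
/- (Lemma 2.6, accuracy of affine interpolation) Let ε > 0 and let x₀, …, x_d ∈ ℝ^d be d+1 points with |x_j| < ε for all j (points in the ε-ball around x = 0). Let V be the (d+1)×(d+1) matrix whose j-th column is (x_j, 1), and assume V is invertible. Let κ : ℝ^d → ℝ^d be twice continuously differentiable on the closed ball of radius ε around 0 with second derivative bounded by M there. Then there is a unique affine map l : ℝ^d → ℝ^d, l(w) = l₀ + Aw, such that l(x_j) = κ(x_j) for j = 0, …, d, and there is a constant C > 0 depending only on d and M such that |κ(0) − l(0)| ≤ C ε² ‖V^{−1}‖, where ‖V^{−1}‖ is the operator norm of V^{−1} (equal to 1/σ_min, the reciprocal of the smallest singular value of V). -/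
section BarycentricCoordinates

variable {d : ℕ} {x : Fin (d + 1) → EuclideanSpace ℝ (Fin d)}
  {V : Matrix (Fin (d + 1)) (Fin (d + 1)) ℝ}

/-- The homogeneous coordinates `(w, 1)` of a point `w`. -/
def homogeneousCoords (w : EuclideanSpace ℝ (Fin d)) : Fin (d + 1) → ℝ :=
  Fin.snoc (α := fun _ => ℝ) (fun i => w i) 1

theorem sum_mulVec_smul_eq
    (hcast : ∀ i j, V (Fin.castSucc i) j = x j i) (hu : IsUnit V)
    (w : EuclideanSpace ℝ (Fin d)) :
    ∑ j, (V⁻¹.mulVec (homogeneousCoords w)) j • x j = w := by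
  have hdet := (Matrix.isUnit_iff_isUnit_det V).mp hu
  have h : V.mulVec (V⁻¹.mulVec (homogeneousCoords w)) = homogeneousCoords w := by
    rw [Matrix.mulVec_mulVec, Matrix.mul_nonsing_inv _ hdet, Matrix.one_mulVec]
  ext i
  have hi := congrFun h (Fin.castSucc i)
  rw [Matrix.mulVec, dotProduct] at hi
  simp only [hcast, homogeneousCoords, Fin.snoc_castSucc] at hi
  simpa [homogeneousCoords, mul_comm] using hi

theorem sum_mulVec_eq_one
    (hlast : ∀ j, V (Fin.last d) j = 1) (hu : IsUnit V)
    (w : EuclideanSpace ℝ (Fin d)) :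
    ∑ j, (V⁻¹.mulVec (homogeneousCoords w)) j = 1 := by
  have hdet := (Matrix.isUnit_iff_isUnit_det V).mp hu
  have h : V.mulVec (V⁻¹.mulVec (homogeneousCoords w)) = homogeneousCoords w := by
    rw [Matrix.mulVec_mulVec, Matrix.mul_nonsing_inv _ hdet, Matrix.one_mulVec]
  have hi := congrFun h (Fin.last d)
  rw [Matrix.mulVec, dotProduct] at hi
  simpa only [hlast, one_mul, homogeneousCoords, Fin.snoc_last] using hi

theorem affine_eq_sum_mulVec_smul
    (hcast : ∀ i j, V (Fin.castSucc i) j = x j i) (hlast : ∀ j, V (Fin.last d) j = 1)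
    (hu : IsUnit V) {F : Type*} [AddCommGroup F] [Module ℝ F] (l₀ : F)
    (A : EuclideanSpace ℝ (Fin d) →ₗ[ℝ] F) (w : EuclideanSpace ℝ (Fin d)) :
    l₀ + A w = ∑ j, (V⁻¹.mulVec (homogeneousCoords w)) j • (l₀ + A (x j)) := by
  simp only [smul_add, Finset.sum_add_distrib]
  rw [← Finset.sum_smul, sum_mulVec_eq_one hlast hu, one_smul]
  conv_lhs => rw [← sum_mulVec_smul_eq hcast hu w]
  simp only [map_sum, map_smul]

theorem exists_affine_interpolant
    (hcast : ∀ i j, V (Fin.castSucc i) j = x j i) (hlast : ∀ j, V (Fin.last d) j = 1)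
    (hu : IsUnit V) {F : Type*} [AddCommGroup F] [Module ℝ F] (b : Fin (d + 1) → F) :
    ∃ (l₀ : F) (A : EuclideanSpace ℝ (Fin d) →ₗ[ℝ] F), ∀ j, l₀ + A (x j) = b j := by
  have hdet := (Matrix.isUnit_iff_isUnit_det V).mp hu
  refine ⟨∑ j, V⁻¹ j (Fin.last d) • b j,
    ∑ j, (∑ i, V⁻¹ j (Fin.castSucc i) • (EuclideanSpace.proj i).toLinearMap).smulRight (b j),
    fun k => ?_⟩
  have h : ∀ j, V⁻¹ j (Fin.last d) + ∑ i, V⁻¹ j (Fin.castSucc i) * x k i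
      = if j = k then 1 else 0 := by
    intro j
    have := congrFun (congrFun (Matrix.nonsing_inv_mul V hdet) j) k
    rw [Matrix.mul_apply, Fin.sum_univ_castSucc, Matrix.one_apply] at this
    simpa only [hcast, hlast, mul_one, add_comm] using this
  simp only [LinearMap.sum_apply, LinearMap.smulRight_apply, LinearMap.smul_apply,
    ← Finset.sum_add_distrib, ← add_smul]
  simp [h]

theorem abs_mulVec_homogeneousCoords_zero_le (B : Matrix (Fin (d + 1)) (Fin (d + 1)) ℝ)
    (j : Fin (d + 1)) :
    |(B.mulVec (homogeneousCoords 0)) j| ≤ ‖Matrix.toEuclideanCLM (𝕜 := ℝ) B‖ := by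
  have he : (homogeneousCoords (0 : EuclideanSpace ℝ (Fin d)))
      = Pi.single (Fin.last d) 1 := by
    ext i
    refine Fin.lastCases ?_ (fun i => ?_) i
    · simp [homogeneousCoords]
    · simp [homogeneousCoords, (Fin.castSucc_lt_last i).ne]
  have h1 := (Matrix.toEuclideanCLM (𝕜 := ℝ) B).le_opNorm
    (EuclideanSpace.single (Fin.last d) (1 : ℝ))
  rw [PiLp.norm_single, norm_one, mul_one] at h1
  refine le_trans ?_ h1
  have h2 := PiLp.norm_apply_le (Matrix.toEuclideanCLM (𝕜 := ℝ) B
    (EuclideanSpace.single (Fin.last d) (1 : ℝ))) j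
  rw [Real.norm_eq_abs] at h2
  rw [he]
  exact h2

end BarycentricCoordinates

/-- First-order Taylor estimate on a closed ball, with a bound on the second derivative. -/
theorem norm_sub_sub_fderivWithin_le {E F : Type*} [NormedAddCommGroup E] [NormedSpace ℝ E]
    [NormedAddCommGroup F] [NormedSpace ℝ F] {f : E → F} {ε M : ℝ} (hε : 0 < ε)
    (hf : ContDiffOn ℝ 2 f (Metric.closedBall 0 ε))
    (hM : ∀ y ∈ Metric.closedBall (0 : E) ε,
      ‖iteratedFDerivWithin ℝ 2 f (Metric.closedBall 0 ε) y‖ ≤ M)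
    {y : E} (hy : y ∈ Metric.closedBall (0 : E) ε) :
    ‖f y - f 0 - fderivWithin ℝ f (Metric.closedBall 0 ε) 0 y‖ ≤ M * ε ^ 2 := by
  set s := Metric.closedBall (0 : E) ε with hs
  have hconv : Convex ℝ s := convex_closedBall 0 ε
  have hud : UniqueDiffOn ℝ s := uniqueDiffOn_convex hconv
    ⟨0, Metric.ball_subset_interior_closedBall (Metric.mem_ball_self hε)⟩
  have h0 : (0 : E) ∈ s := Metric.mem_closedBall_self hε.le
  have hM0 : 0 ≤ M := (norm_nonneg _).trans (hM 0 h0)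
  have hd : DifferentiableOn ℝ (fderivWithin ℝ f s) s :=
    (hf.fderivWithin hud (m := 1) (by norm_num)).differentiableOn (by norm_num)
  have hbound : ∀ z ∈ s, ‖fderivWithin ℝ (fderivWithin ℝ f s) s z‖ ≤ M := by
    intro z hz
    rw [← norm_iteratedFDerivWithin_one _ (hud z hz),
      norm_iteratedFDerivWithin_fderivWithin hud hz]
    exact hM z hz
  have hlip : ∀ z ∈ s, ‖fderivWithin ℝ f s z - fderivWithin ℝ f s 0‖ ≤ M * ε := by
    intro z hz
    have h := hconv.norm_image_sub_le_of_norm_fderivWithin_le hd hbound h0 hz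
    rw [sub_zero] at h
    exact h.trans (mul_le_mul_of_nonneg_left (mem_closedBall_zero_iff.mp hz) hM0)
  have h := hconv.norm_image_sub_le_of_norm_fderivWithin_le' (hf.differentiableOn (by norm_num))
    hlip h0 hy
  rw [sub_zero] at h
  calc _ ≤ M * ε * ‖y‖ := h
    _ ≤ M * ε * ε := mul_le_mul_of_nonneg_left (mem_closedBall_zero_iff.mp hy) (by positivity)
    _ = M * ε ^ 2 := by ring


open Metric in
/-- **Lemma 2.6: accuracy of affine interpolation.**
There is a constant `c > 0`, depending only on the dimension `d` and the second
derivative bound `M`, such that: for any `ε > 0` and interpolation points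
`x₀, …, x_d` in the `ε`-ball around `0` in `ℝ^d`, if the `(d+1)×(d+1)` matrix `V`
whose `j`-th column is `(x_j, 1)` is invertible, and `κ : ℝ^d → ℝ^d` is `C²` on the
closed `ε`-ball around `0` with second derivative bounded by `M` there, then there is a
unique affine map `l (w) = l₀ + A w` with `l (x_j) = κ (x_j)` for `j = 0, …, d`, and any
such affine interpolant satisfies `|κ(0) - l(0)| ≤ c ε² ‖V⁻¹‖`, where `‖V⁻¹‖` is the
operator norm of `V⁻¹` (which equals `1/σ_min`). -/
theorem affine_interpolation_accuracy (d : ℕ) (M : ℝ) :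
    ∃ c : ℝ, 0 < c ∧
      ∀ (ε : ℝ), 0 < ε →
      ∀ (x : Fin (d + 1) → EuclideanSpace ℝ (Fin d)), (∀ j, ‖x j‖ < ε) →
      ∀ (V : Matrix (Fin (d + 1)) (Fin (d + 1)) ℝ),
        (∀ (i j : Fin (d + 1)), V i j =
          if h : (i : ℕ) < d then x j ⟨(i : ℕ), h⟩ else 1) →
        IsUnit V →
      ∀ (κ : EuclideanSpace ℝ (Fin d) → EuclideanSpace ℝ (Fin d)),
        ContDiffOn ℝ 2 κ (closedBall 0 ε) →
        (∀ y ∈ closedBall (0 : EuclideanSpace ℝ (Fin d)) ε,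
          ‖iteratedFDerivWithin ℝ 2 κ (closedBall 0 ε) y‖ ≤ M) →
        (∃! l : EuclideanSpace ℝ (Fin d) → EuclideanSpace ℝ (Fin d),
          (∃ (l₀ : EuclideanSpace ℝ (Fin d))
             (A : EuclideanSpace ℝ (Fin d) →ₗ[ℝ] EuclideanSpace ℝ (Fin d)),
            ∀ w, l w = l₀ + A w) ∧ (∀ j, l (x j) = κ (x j))) ∧
        (∀ (l₀ : EuclideanSpace ℝ (Fin d))
           (A : EuclideanSpace ℝ (Fin d) →ₗ[ℝ] EuclideanSpace ℝ (Fin d)),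
          (∀ j, l₀ + A (x j) = κ (x j)) →
          ‖κ 0 - (l₀ + A 0)‖ ≤
            c * ε ^ 2 * ‖Matrix.toEuclideanCLM (𝕜 := ℝ) V⁻¹‖) := by
  refine ⟨(d + 1) * (|M| + 1), by positivity, ?_⟩
  intro ε hε x hx V hV hu κ hκ hM
  have hcast : ∀ i j, V (Fin.castSucc i) j = x j i := fun i j => by simp [hV]
  have hlast : ∀ j, V (Fin.last d) j = 1 := fun j => by simp [hV]
  refine ⟨?_, ?_⟩
  · obtain ⟨l₀, A, h⟩ := exists_affine_interpolant hcast hlast hu (fun j => κ (x j))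
    refine ⟨fun w => l₀ + A w, ⟨⟨l₀, A, fun _ => rfl⟩, h⟩, ?_⟩
    rintro l ⟨⟨m₀, B, hl⟩, hlx⟩
    funext w
    simp only [hl] at hlx ⊢
    rw [affine_eq_sum_mulVec_smul hcast hlast hu m₀ B w,
      affine_eq_sum_mulVec_smul hcast hlast hu l₀ A w]
    simp only [hlx, h]
  · intro l₀ A h
    set D := fderivWithin ℝ κ (closedBall 0 ε) 0
    set a := V⁻¹.mulVec (homogeneousCoords (0 : EuclideanSpace ℝ (Fin d)))
    have hl := affine_eq_sum_mulVec_smul hcast hlast hu l₀ A 0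
    have hk := affine_eq_sum_mulVec_smul hcast hlast hu (κ 0) D.toLinearMap 0
    rw [map_zero, add_zero] at hk
    have hsub : l₀ + A 0 - κ 0 = ∑ j, a j • (κ (x j) - κ 0 - D (x j)) := by
      rw [hl]
      nth_rewrite 1 [hk]
      rw [← Finset.sum_sub_distrib]
      refine Finset.sum_congr rfl fun j _ => ?_
      rw [h, ← smul_sub, sub_sub]
      rfl
    have hterm : ∀ j ∈ Finset.univ, ‖a j • (κ (x j) - κ 0 - D (x j))‖ ≤
        ‖Matrix.toEuclideanCLM (𝕜 := ℝ) V⁻¹‖ * ((|M| + 1) * ε ^ 2) := by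
      intro j _
      rw [norm_smul, Real.norm_eq_abs]
      refine mul_le_mul (abs_mulVec_homogeneousCoords_zero_le _ j) ?_ (norm_nonneg _)
        (norm_nonneg _)
      refine (norm_sub_sub_fderivWithin_le hε hκ hM
        (mem_closedBall_zero_iff.mpr (hx j).le)).trans ?_
      exact mul_le_mul_of_nonneg_right (by linarith [le_abs_self M]) (by positivity)
    rw [norm_sub_rev, hsub]
    refine (norm_sum_le_of_le _ hterm).trans_eq ?_
    rw [Finset.sum_const, Finset.card_univ, Fintype.card_fin, nsmul_eq_mul]
    push_cast
    ring
end

section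
/- (Local accuracy of the interpolative θ-parareal update) Let x ∈ ℝ^d, ε > 0, and let x₀, …, x_d ∈ ℝ^d be d+1 points with |x_j − x| < ε for all j. Let V be the (d+1)×(d+1) matrix whose j-th column is (x_j − x, 1) and assume V is invertible. Suppose κ := F − C : ℝ^d → ℝ^d is twice continuously differentiable on the closed ε-ball around x with second derivative bounded by M there, and let l be the unique affine map with l(x_j) = κ(x_j) for j = 0, …, d. Then the interpolative θ-parareal update w := C(x) + l(x) satisfies |w − F(x)| ≤ C' ε² ‖V^{−1}‖ for a constant C' > 0 depending only on d and M; i.e., the improved coarse integrator C + l approximates the fine integrator F at x to within O(ε²/σ_min). -/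
open Metric in
/-- First-order Taylor estimate on a closed ball: if the second derivative of `f` is bounded by `M`
there, then `f` differs from its linearization at the center by at most `M ε ^ 2`. -/
lemma norm_sub_sub_fderivWithin_le_of_norm_iteratedFDerivWithin_two_le
    {E G : Type*} [NormedAddCommGroup E] [NormedSpace ℝ E] [NormedAddCommGroup G]
    [NormedSpace ℝ G] {f : E → G} {x y : E} {ε M : ℝ} (hε : 0 < ε)
    (hf : ContDiffOn ℝ 2 f (closedBall x ε))
    (hM : ∀ z ∈ closedBall x ε, ‖iteratedFDerivWithin ℝ 2 f (closedBall x ε) z‖ ≤ M)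
    (hy : y ∈ closedBall x ε) :
    ‖f y - f x - fderivWithin ℝ f (closedBall x ε) x (y - x)‖ ≤ M * ε ^ 2 := by
  have hconv : Convex ℝ (closedBall x ε) := convex_closedBall x ε
  have hu : UniqueDiffOn ℝ (closedBall x ε) :=
    uniqueDiffOn_convex hconv ⟨x, ball_subset_interior_closedBall (mem_ball_self hε)⟩
  have hx : x ∈ closedBall x ε := mem_closedBall_self hε.le
  have hM0 : 0 ≤ M := (norm_nonneg _).trans (hM x hx)
  have hd : DifferentiableOn ℝ (fderivWithin ℝ f (closedBall x ε)) (closedBall x ε) :=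
    (hf.fderivWithin hu (m := 1) (by norm_num)).differentiableOn one_ne_zero
  have hlip : ∀ z ∈ closedBall x ε,
      ‖fderivWithin ℝ f (closedBall x ε) z - fderivWithin ℝ f (closedBall x ε) x‖ ≤ M * ε := by
    intro z hz
    refine (hconv.norm_image_sub_le_of_norm_fderivWithin_le (C := M) hd ?_ hx hz).trans ?_
    · intro w hw
      rw [← norm_iteratedFDerivWithin_one _ (hu w hw),
        norm_iteratedFDerivWithin_fderivWithin hu hw]
      exact hM w hw
    · gcongr
      exact mem_closedBall_iff_norm.mp hz
  refine (hconv.norm_image_sub_le_of_norm_hasFDerivWithin_le'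
    (fun z hz => ((hf.differentiableOn two_ne_zero) z hz).hasFDerivWithinAt) hlip hx hy).trans ?_
  calc M * ε * ‖y - x‖ ≤ M * ε * ε := by
        gcongr
        exact mem_closedBall_iff_norm.mp hy
    _ = M * ε ^ 2 := by ring

/-- If the affine-coordinate matrix `V` of the points `pts` around `x` is invertible, then `x` is an
affine combination of the points with coefficients bounded by the operator norm of `V⁻¹`. -/
lemma exists_affine_coefficients_abs_le_norm_inv {d : ℕ} {x : EuclideanSpace ℝ (Fin d)}
    {pts : Fin (d + 1) → EuclideanSpace ℝ (Fin d)}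
    {V : Matrix (Fin (d + 1)) (Fin (d + 1)) ℝ}
    (hV : ∀ i j : Fin (d + 1), V i j =
      if h : (i : ℕ) < d then (pts j - x) ⟨(i : ℕ), h⟩ else 1)
    (hunit : IsUnit V) :
    ∃ a : Fin (d + 1) → ℝ, ∑ j, a j = 1 ∧ ∑ j, a j • (pts j - x) = 0 ∧
      ∀ j, |a j| ≤ ‖Matrix.toEuclideanCLM (𝕜 := ℝ) V⁻¹‖ := by
  set e : EuclideanSpace ℝ (Fin (d + 1)) := EuclideanSpace.single (Fin.last d) 1 with he
  set a : EuclideanSpace ℝ (Fin (d + 1)) := Matrix.toEuclideanCLM (𝕜 := ℝ) V⁻¹ e with ha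
  have hVa : Matrix.toEuclideanCLM (𝕜 := ℝ) V a = e := by
    rw [ha, ← mul_apply_eq_comp, ← map_mul,
      Matrix.mul_nonsing_inv _ ((Matrix.isUnit_iff_isUnit_det V).mp hunit), map_one,
      one_apply_eq_self]
  have hrow : ∀ i, ∑ j, V i j * a j = e i := by
    intro i
    rw [← hVa, Matrix.ofLp_toEuclideanCLM]
    rfl
  refine ⟨a, ?_, ?_, fun j => ?_⟩
  · simpa [hV, he] using hrow (Fin.last d)
  · ext i
    have h := hrow i.castSucc
    simp only [hV, he, Fin.val_castSucc, i.isLt, dif_pos, PiLp.single_apply,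
      (Fin.castSucc_lt_last i).ne, if_false] at h
    simpa [mul_comm] using h
  · calc |a j| ≤ ‖a‖ := by simpa using PiLp.norm_apply_le a j
      _ ≤ ‖Matrix.toEuclideanCLM (𝕜 := ℝ) V⁻¹‖ * ‖e‖ := ContinuousLinearMap.le_opNorm _ _
      _ = ‖Matrix.toEuclideanCLM (𝕜 := ℝ) V⁻¹‖ := by simp [he]


open Metric in
/-- **Local accuracy of the interpolative θ-parareal update.**
There is a constant `c > 0`, depending only on the dimension `d` and the second
derivative bound `M`, such that: for any `x ∈ ℝ^d`, `ε > 0`, and points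
`x₀, …, x_d` with `|x_j - x| < ε`, if the `(d+1)×(d+1)` matrix `V` whose `j`-th column
is `(x_j - x, 1)` is invertible, `κ := F - C` is `C²` on the closed `ε`-ball around `x`
with second derivative bounded by `M` there, and `l (w) = l₀ + A w` is an affine map
with `l (x_j) = κ (x_j)` for all `j`, then the interpolative θ-parareal update
`w := C(x) + l(x)` satisfies `|w - F(x)| ≤ c ε² ‖V⁻¹‖`; i.e. the improved coarse
integrator `C + l` approximates the fine integrator `F` at `x` to within
`O(ε²/σ_min)`. -/
theorem interpolative_theta_parareal_local_accuracy (d : ℕ) (M : ℝ) :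
    ∃ c : ℝ, 0 < c ∧
      ∀ (x : EuclideanSpace ℝ (Fin d)) (ε : ℝ), 0 < ε →
      ∀ (pts : Fin (d + 1) → EuclideanSpace ℝ (Fin d)), (∀ j, ‖pts j - x‖ < ε) →
      ∀ (V : Matrix (Fin (d + 1)) (Fin (d + 1)) ℝ),
        (∀ (i j : Fin (d + 1)), V i j =
          if h : (i : ℕ) < d then (pts j - x) ⟨(i : ℕ), h⟩ else 1) →
        IsUnit V →
      ∀ (C F : EuclideanSpace ℝ (Fin d) → EuclideanSpace ℝ (Fin d)),
        ContDiffOn ℝ 2 (fun w => F w - C w) (closedBall x ε) →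
        (∀ y ∈ closedBall x ε,
          ‖iteratedFDerivWithin ℝ 2 (fun w => F w - C w) (closedBall x ε) y‖ ≤ M) →
      ∀ (l₀ : EuclideanSpace ℝ (Fin d))
        (A : EuclideanSpace ℝ (Fin d) →ₗ[ℝ] EuclideanSpace ℝ (Fin d)),
        (∀ j, l₀ + A (pts j) = F (pts j) - C (pts j)) →
        ‖(C x + (l₀ + A x)) - F x‖ ≤
          c * ε ^ 2 * ‖Matrix.toEuclideanCLM (𝕜 := ℝ) V⁻¹‖ := by
  refine ⟨(d + 1) * (|M| + 1), by positivity, ?_⟩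
  intro x ε hε pts hpts V hV hunit C F hκ hM l₀ A hl
  obtain ⟨a, ha1, ha0, hab⟩ := exists_affine_coefficients_abs_le_norm_inv hV hunit
  set N := ‖Matrix.toEuclideanCLM (𝕜 := ℝ) V⁻¹‖
  set D := fderivWithin ℝ (fun w => F w - C w) (closedBall x ε) x
  have key : (C x + (l₀ + A x)) - F x =
      ∑ j, a j • ((F (pts j) - C (pts j)) - (F x - C x) - D (pts j - x)) := by
    have hD : ∑ j, a j • D (pts j - x) = 0 := by
      simpa only [map_sum, map_smul, map_zero] using congrArg D ha0
    have hA : ∑ j, a j • A (pts j - x) = 0 := by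
      simpa only [map_sum, map_smul, map_zero] using congrArg A ha0
    have hval : ∀ j, F (pts j) - C (pts j) = (l₀ + A x) + A (pts j - x) := by
      intro j
      rw [← hl j, map_sub]
      abel
    simp only [hval, smul_sub, smul_add, Finset.sum_sub_distrib, Finset.sum_add_distrib, hD, hA,
      ← Finset.sum_smul, ha1, one_smul]
    abel
  rw [key]
  calc _ ≤ ∑ j, ‖a j • ((F (pts j) - C (pts j)) - (F x - C x) - D (pts j - x))‖ :=
        norm_sum_le _ _
    _ ≤ ∑ _j : Fin (d + 1), N * ((|M| + 1) * ε ^ 2) := by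
        refine Finset.sum_le_sum fun j _ => ?_
        rw [norm_smul, Real.norm_eq_abs]
        refine mul_le_mul (hab j) ?_ (norm_nonneg _) (norm_nonneg _)
        refine (norm_sub_sub_fderivWithin_le_of_norm_iteratedFDerivWithin_two_le hε hκ hM
          (mem_closedBall_iff_norm.mpr (hpts j).le)).trans ?_
        gcongr
        linarith [le_abs_self M]
    _ = (d + 1) * (|M| + 1) * ε ^ 2 * N := by
        simp only [Finset.sum_const, Finset.card_univ, Fintype.card_fin, nsmul_eq_mul]
        push_cast
        ring
end
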